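/- For every n ≥ 1 and λ > 0, the horizontal perimeter of the Pansu ball equals the sub-Riemannian area of its boundary graphs: P(B_λ) = 2·∫_{{z ∈ ℝ^{2n} : |z| < 1/λ}} |z|·(1−λ²|z|²)^{−1/2} dz, where dz denotes Lebesgue measure on ℝ^{2n}. -/

import Mathlib

open MeasureTheory Real Filter Set
open scoped BigOperators ENNReal NNReal Topology

noncomputable section

/-- The Heisenberg group `ℍⁿ` modeled as `ℝⁿ × ℝⁿ × ℝ`, coordinates `(x, y, t)`. -/
abbrev Hei (n : ℕ) : Type := (Fin n → ℝ) × (Fin n → ℝ) × ℝ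

/-- Euclidean norm of the horizontal component `z = (x,y)` of a point. -/
def zNorm {n : ℕ} (p : Hei n) : ℝ := Real.sqrt (∑ i, ((p.1 i) ^ 2 + (p.2.1 i) ^ 2))

/-- Derivative along the left-invariant frame field `Xᵢ = ∂/∂xᵢ + yᵢ ∂/∂t`. -/
def Xder {n : ℕ} (F : Hei n → ℝ) (i : Fin n) (p : Hei n) : ℝ :=
  fderiv ℝ F p (Pi.single i 1, 0, 0) + p.2.1 i * fderiv ℝ F p (0, 0, 1)

/-- Derivative along the left-invariant frame field `Yᵢ = ∂/∂yᵢ − xᵢ ∂/∂t`. -/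
def Yder {n : ℕ} (F : Hei n → ℝ) (i : Fin n) (p : Hei n) : ℝ :=
  fderiv ℝ F p (0, Pi.single i 1, 0) - p.1 i * fderiv ℝ F p (0, 0, 1)

/-- Horizontal divergence of the horizontal field with frame coefficients `(a, b)`. -/
def hDivergence {n : ℕ} (a b : Hei n → Fin n → ℝ) (p : Hei n) : ℝ :=
  ∑ i, (Xder (fun q => a q i) i p + Yder (fun q => b q i) i p)

/-- Admissible test fields for the horizontal perimeter in an open set `Ω`:
`C¹` with compact support in `Ω` and pointwise length at most `1`. -/
def IsAdmissible {n : ℕ} (Ω : Set (Hei n)) (a b : Hei n → Fin n → ℝ) : Prop :=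
  ContDiff ℝ 1 a ∧ ContDiff ℝ 1 b ∧ HasCompactSupport a ∧ HasCompactSupport b ∧
  tsupport a ⊆ Ω ∧ tsupport b ⊆ Ω ∧ ∀ p, ∑ i, ((a p i) ^ 2 + (b p i) ^ 2) ≤ 1

/-- Horizontal (sub-Riemannian) perimeter of `E` relative to the open set `Ω`. -/
def hPerimeter {n : ℕ} (E Ω : Set (Hei n)) : ℝ≥0∞ :=
  ⨆ ab : {ab : (Hei n → Fin n → ℝ) × (Hei n → Fin n → ℝ) // IsAdmissible Ω ab.1 ab.2},
    ENNReal.ofReal (∫ p in E, hDivergence ab.1.1 ab.1.2 p)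

/-- Profile function `f_λ` of the Pansu sphere. -/
def pansuProfile (lam ρ : ℝ) : ℝ :=
  (1 / (2 * lam ^ 2)) * (lam * ρ * Real.sqrt (1 - lam ^ 2 * ρ ^ 2) + Real.arccos (lam * ρ))

/-- The Pansu ball `B_λ`. -/
def pansuBall (n : ℕ) (lam : ℝ) : Set (Hei n) :=
  {p | zNorm p ≤ 1 / lam ∧ |p.2.2| ≤ pansuProfile lam (zNorm p)}

/-- The Pansu sphere `S_λ = ∂B_λ`. -/
def pansuSphere (n : ℕ) (lam : ℝ) : Set (Hei n) :=
  {p | zNorm p ≤ 1 / lam ∧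
    (p.2.2 = pansuProfile lam (zNorm p) ∨ p.2.2 = -pansuProfile lam (zNorm p))}

/-- The closed vertical cylinder `C_r` over the disk of radius `r`. -/
def cylinder (n : ℕ) (r : ℝ) : Set (Hei n) := {p | zNorm p ≤ r}

/-- The closed horizontal disk `D_r` in the hyperplane `{t = 0}`. -/
def disk (n : ℕ) (r : ℝ) : Set (Hei n) := {p | zNorm p ≤ r ∧ p.2.2 = 0}

/-- `p` is a point of Lebesgue density one of `E`. -/
def DensityOnePoint {n : ℕ} (E : Set (Hei n)) (p : Hei n) : Prop :=
  Tendsto (fun ρ => volume (E ∩ Metric.closedBall p ρ) / volume (Metric.closedBall p ρ))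
    (nhdsWithin 0 (Set.Ioi 0)) (nhds 1)

/-- Euclidean norm on `ℝ^{2n} = ℝⁿ × ℝⁿ`, the space of horizontal coordinates `z`. -/
def zNorm2 {n : ℕ} (z : (Fin n → ℝ) × (Fin n → ℝ)) : ℝ :=
  Real.sqrt (∑ i, ((z.1 i) ^ 2 + (z.2 i) ^ 2))

/-! ### One-dimensional preliminaries -/

/-- A `C¹` truncation of the identity on `[0,∞)`. -/
def phi (c s : ℝ) : ℝ := (max (s - c) 0) ^ 2 / (max (s - c) 0 + c)

/-- The derivative of `phi c`. -/
def dphi (c s : ℝ) : ℝ := 1 - c ^ 2 / (max (s - c) 0 + c) ^ 2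

lemma phi_den_pos {c : ℝ} (hc : 0 < c) (s : ℝ) : 0 < max (s - c) 0 + c := by
  have := le_max_right (s - c) 0
  linarith

lemma continuous_phi {c : ℝ} (hc : 0 < c) : Continuous (phi c) := by
  unfold phi
  exact Continuous.div (by fun_prop) (by fun_prop) (fun s => (phi_den_pos hc s).ne')

lemma continuous_dphi {c : ℝ} (hc : 0 < c) : Continuous (dphi c) := by
  unfold dphi
  exact continuous_const.sub (Continuous.div (by fun_prop) (by fun_prop)
    (fun s => (pow_pos (phi_den_pos hc s) 2).ne'))

lemma phi_of_le {c s : ℝ} (h : s ≤ c) : phi c s = 0 := by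
  simp [phi, max_eq_right (sub_nonpos.2 h)]

lemma dphi_of_le {c s : ℝ} (hc : 0 < c) (h : s ≤ c) : dphi c s = 0 := by
  have : c ^ 2 ≠ 0 := by positivity
  simp [dphi, max_eq_right (sub_nonpos.2 h), this]

lemma phi_of_ge {c s : ℝ} (h : c ≤ s) : phi c s = (s - c) ^ 2 / s := by
  simp [phi, max_eq_left (sub_nonneg.2 h)]

lemma dphi_of_ge {c s : ℝ} (h : c ≤ s) : dphi c s = 1 - c ^ 2 / s ^ 2 := by
  simp [dphi, max_eq_left (sub_nonneg.2 h)]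

lemma hasDerivAt_phi {c : ℝ} (hc : 0 < c) (s : ℝ) : HasDerivAt (phi c) (dphi c s) s := by
  refine hasDerivAt_of_hasDerivAt_of_ne' (x := c) (fun y hy => ?_)
    (continuous_phi hc).continuousAt (continuous_dphi hc).continuousAt s
  rcases lt_or_gt_of_ne hy with h | h
  · rw [dphi_of_le hc h.le]
    refine (hasDerivAt_const y (0 : ℝ)).congr_of_eventuallyEq ?_
    filter_upwards [Iio_mem_nhds h] with r hr using phi_of_le (le_of_lt hr)
  · rw [dphi_of_ge (le_of_lt h)]
    have hy0 : y ≠ 0 := (hc.trans h).ne'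
    have h1 : HasDerivAt (fun s : ℝ => (s - c) ^ 2 / s)
        ((2 * (y - c) * y - (y - c) ^ 2) / y ^ 2) y := by
      have := (((hasDerivAt_id y).sub_const c).pow 2).div (hasDerivAt_id y) hy0
      simpa using! this
    have h2 : (1 - c ^ 2 / y ^ 2) = ((2 * (y - c) * y - (y - c) ^ 2) / y ^ 2) := by
      field_simp
      ring
    rw [h2]
    refine h1.congr_of_eventuallyEq ?_
    filter_upwards [Ioi_mem_nhds h] with r hr using phi_of_ge (le_of_lt hr)

lemma dphi_nonneg {c : ℝ} (hc : 0 < c) (s : ℝ) : 0 ≤ dphi c s := by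
  rcases le_total s c with h | h
  · rw [dphi_of_le hc h]
  · rw [dphi_of_ge h, sub_nonneg, div_le_one (by have := hc.trans_le h; positivity)]
    gcongr

lemma dphi_le_one (c s : ℝ) : dphi c s ≤ 1 := by
  unfold dphi
  have : 0 ≤ c ^ 2 / (max (s - c) 0 + c) ^ 2 := by positivity
  linarith

lemma phi_nonneg {c : ℝ} (hc : 0 < c) (s : ℝ) : 0 ≤ phi c s :=
  div_nonneg (sq_nonneg _) (phi_den_pos hc s).le

lemma phi_le {c s : ℝ} (hc : 0 < c) (hs : 0 ≤ s) : phi c s ≤ s := by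
  rcases le_total s c with h | h
  · rwa [phi_of_le h]
  · rw [phi_of_ge h, div_le_iff₀ (hc.trans_le h)]
    nlinarith

/-- The sequence of truncation levels. -/
def cseq (k : ℕ) : ℝ := 1 / ((k : ℝ) + 1)

lemma cseq_pos (k : ℕ) : 0 < cseq k := Nat.one_div_pos_of_nat

lemma tendsto_cseq : Tendsto cseq atTop (𝓝 0) := tendsto_one_div_add_atTop_nhds_zero_nat

lemma tendsto_phi {s : ℝ} (hs : 0 ≤ s) : Tendsto (fun k => phi (cseq k) s) atTop (𝓝 s) := by
  rcases hs.eq_or_lt with rfl | hs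
  · refine tendsto_const_nhds.congr (fun k => (phi_of_le (cseq_pos k).le).symm)
  · have h : Tendsto (fun k => (s - cseq k) ^ 2 / s) atTop (𝓝 ((s - 0) ^ 2 / s)) :=
      ((tendsto_const_nhds.sub tendsto_cseq).pow 2).div_const s
    have h2 : (s - 0) ^ 2 / s = s := by field_simp; ring
    rw [h2] at h
    refine h.congr' ?_
    filter_upwards [tendsto_cseq.eventually (Iio_mem_nhds hs)] with k hk
    exact (phi_of_ge (le_of_lt hk)).symm

lemma tendsto_dphi {s : ℝ} (hs : 0 < s) : Tendsto (fun k => dphi (cseq k) s) atTop (𝓝 1) := by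
  have h : Tendsto (fun k => 1 - (cseq k) ^ 2 / s ^ 2) atTop (𝓝 (1 - 0 ^ 2 / s ^ 2)) :=
    tendsto_const_nhds.sub ((tendsto_cseq.pow 2).div_const _)
  have h2 : (1 : ℝ) - 0 ^ 2 / s ^ 2 = 1 := by simp
  rw [h2] at h
  refine h.congr' ?_
  filter_upwards [tendsto_cseq.eventually (Iio_mem_nhds hs)] with k hk
  exact (dphi_of_ge (le_of_lt hk)).symm

/-- The profile as a function of `q = |z|²`. -/
def gprof (lam q : ℝ) : ℝ := pansuProfile lam (√q)

/-- Its derivative. -/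
def dgprof (lam q : ℝ) : ℝ := -(lam * √q) / (2 * √(1 - lam ^ 2 * (√q) ^ 2))

lemma continuous_gprof (lam : ℝ) : Continuous (gprof lam) := by
  unfold gprof pansuProfile
  have := Real.continuous_arccos
  fun_prop

lemma gprof_of_ge {lam q : ℝ} (hl : 0 < lam) (h : 1 ≤ lam ^ 2 * q) : gprof lam q = 0 := by
  have hq : 0 < q := by
    by_contra hq
    push Not at hq
    nlinarith [sq_nonneg lam]
  have h1 : 1 ≤ lam * √q := by
    have : √(lam ^ 2 * q) = lam * √q := by rw [Real.sqrt_mul (by positivity), Real.sqrt_sq hl.le]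
    rw [← this]
    exact Real.one_le_sqrt.2 h
  unfold gprof pansuProfile
  rw [Real.arccos_eq_zero.2 h1, Real.sq_sqrt hq.le, Real.sqrt_eq_zero_of_nonpos (show 1 - lam ^ 2 * q ≤ 0 by linarith)]
  simp

lemma lam_sqrt_lt_one {lam q : ℝ} (hl : 0 < lam) (h : lam ^ 2 * q < 1) : lam * √q < 1 := by
  have : √(lam ^ 2 * q) = lam * √q := by rw [Real.sqrt_mul (by positivity), Real.sqrt_sq hl.le]
  rw [← this]
  rw [Real.sqrt_lt' one_pos]; simpa using h

lemma gprof_pos {lam q : ℝ} (hl : 0 < lam) (h : lam ^ 2 * q < 1) : 0 < gprof lam q := by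
  have h1 := lam_sqrt_lt_one hl h
  have h2 : 0 < Real.arccos (lam * √q) := Real.arccos_pos.2 h1
  unfold gprof pansuProfile
  positivity

lemma gprof_nonneg {lam : ℝ} (hl : 0 < lam) (q : ℝ) : 0 ≤ gprof lam q := by
  rcases lt_or_ge (lam ^ 2 * q) 1 with h | h
  · exact (gprof_pos hl h).le
  · exact (gprof_of_ge hl h).ge

lemma one_sub_pos {lam q : ℝ} (hl : 0 < lam) (h : lam ^ 2 * q < 1) :
    0 < 1 - lam ^ 2 * (√q) ^ 2 := by
  have h1 := lam_sqrt_lt_one hl h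
  have h2 : 0 ≤ lam * √q := by positivity
  nlinarith

lemma dgprof_of_ge {lam q : ℝ} (h : 1 ≤ lam ^ 2 * q) : dgprof lam q = 0 := by
  have hq : 0 < q := by
    by_contra hq
    push Not at hq
    nlinarith [sq_nonneg lam]
  unfold dgprof
  rw [Real.sq_sqrt hq.le, Real.sqrt_eq_zero_of_nonpos (show 1 - lam ^ 2 * q ≤ 0 by linarith)]
  simp

lemma continuousAt_dgprof {lam q : ℝ} (hl : 0 < lam) (h : lam ^ 2 * q < 1) :
    ContinuousAt (dgprof lam) q := by
  unfold dgprof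
  have := Real.sqrt_pos.2 (one_sub_pos hl h)
  refine ContinuousAt.div (by fun_prop) (by fun_prop) (by positivity)

lemma hasDerivAt_gprof {lam q : ℝ} (hl : 0 < lam) (hq : q ≠ 0) (h : lam ^ 2 * q < 1) :
    HasDerivAt (gprof lam) (dgprof lam q) q := by
  rcases lt_or_gt_of_ne hq with hq | hq
  · have h0 : dgprof lam q = 0 := by simp [dgprof, Real.sqrt_eq_zero_of_nonpos hq.le]
    rw [h0]
    refine (hasDerivAt_const q (pansuProfile lam 0)).congr_of_eventuallyEq ?_
    filter_upwards [Iio_mem_nhds hq] with r hr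
    simp [gprof, Real.sqrt_eq_zero_of_nonpos (le_of_lt hr)]
  · have hs := one_sub_pos hl h
    have h1 := lam_sqrt_lt_one hl h
    have hr : 0 < √q := Real.sqrt_pos.2 hq
    have hsp := Real.sqrt_pos.2 hs
    have d0 : HasDerivAt (fun q : ℝ => √q) (1 / (2 * √q)) q := Real.hasDerivAt_sqrt hq.ne'
    have d1 : HasDerivAt (fun ρ : ℝ => pansuProfile lam ρ)
        (-(lam * (√q) ^ 2) / √(1 - lam ^ 2 * (√q) ^ 2)) (√q) := by
      unfold pansuProfile
      have e1 : HasDerivAt (fun ρ : ℝ => lam * ρ) lam (√q) := by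
        simpa using (hasDerivAt_id (√q)).const_mul lam
      have e2 : HasDerivAt (fun ρ : ℝ => 1 - lam ^ 2 * ρ ^ 2) (-(lam ^ 2 * (2 * √q))) (√q) := by
        simpa using ((hasDerivAt_pow 2 (√q)).const_mul (lam ^ 2)).const_sub 1
      have e3 := e2.sqrt hs.ne'
      have hne : lam * √q ≠ -1 := by
        have : 0 < lam * √q := by positivity
        linarith
      have e4 := (Real.hasDerivAt_arccos hne h1.ne).comp (√q) e1
      have e5 := ((e1.mul e3).add e4).const_mul (1 / (2 * lam ^ 2))
      refine e5.congr_deriv ?_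
      have h5 : 1 - (lam * √q) ^ 2 = 1 - lam ^ 2 * √q ^ 2 := by ring
      rw [h5]
      have h6 : √(1 - lam ^ 2 * √q ^ 2) ^ 2 = 1 - lam ^ 2 * √q ^ 2 := Real.sq_sqrt hs.le
      generalize √(1 - lam ^ 2 * √q ^ 2) = S at *
      field_simp
      rw [h6]
      ring
    refine (d1.comp q d0).congr_deriv ?_
    unfold dgprof
    field_simp

/-- Truncated profile as a function of `q`. -/
def Phi (lam c q : ℝ) : ℝ := phi c (gprof lam q)

/-- Its derivative. -/
def dPhi (lam c q : ℝ) : ℝ := dphi c (gprof lam q) * dgprof lam q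

lemma gprof_ev_lt {lam c q : ℝ} (hl : 0 < lam) (hc : 0 < c) (h : 1 ≤ lam ^ 2 * q) :
    ∀ᶠ r in 𝓝 q, gprof lam r < c := by
  have : gprof lam q < c := by rw [gprof_of_ge hl h]; exact hc
  exact (continuous_gprof lam).continuousAt.eventually (Iio_mem_nhds this)

lemma continuous_dPhi {lam c : ℝ} (hl : 0 < lam) (hc : 0 < c) : Continuous (dPhi lam c) := by
  rw [continuous_iff_continuousAt]
  intro q
  rcases lt_or_ge (lam ^ 2 * q) 1 with h | h
  · exact (((continuous_dphi hc).comp (continuous_gprof lam)).continuousAt).mul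
      (continuousAt_dgprof hl h)
  · have : dPhi lam c =ᶠ[𝓝 q] fun _ => 0 := by
      filter_upwards [gprof_ev_lt hl hc h] with r hr
      simp [dPhi, dphi_of_le hc hr.le]
    exact continuousAt_const.congr this.symm

lemma hasDerivAt_Phi {lam c : ℝ} (hl : 0 < lam) (hc : 0 < c) (q : ℝ) :
    HasDerivAt (Phi lam c) (dPhi lam c q) q := by
  refine hasDerivAt_of_hasDerivAt_of_ne' (x := 0) (fun y hy => ?_)
    ((continuous_phi hc).comp (continuous_gprof lam)).continuousAt
    (continuous_dPhi hl hc).continuousAt q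
  rcases lt_or_ge (lam ^ 2 * y) 1 with h | h
  · exact (hasDerivAt_phi hc _).comp y (hasDerivAt_gprof hl hy h)
  · have h0 : dPhi lam c y = 0 := by simp [dPhi, dgprof_of_ge h]
    rw [h0]
    refine (hasDerivAt_const y (0 : ℝ)).congr_of_eventuallyEq ?_
    filter_upwards [gprof_ev_lt hl hc h] with r hr using phi_of_le hr.le

lemma contDiff_Phi {lam c : ℝ} (hl : 0 < lam) (hc : 0 < c) : ContDiff ℝ 1 (Phi lam c) := by
  rw [contDiff_one_iff_deriv]
  refine ⟨fun q => (hasDerivAt_Phi hl hc q).differentiableAt, ?_⟩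
  have : deriv (Phi lam c) = dPhi lam c := funext fun q => (hasDerivAt_Phi hl hc q).deriv
  rw [this]
  exact continuous_dPhi hl hc

/-! ### The horizontal space -/

/-- The space of horizontal coordinates. -/
abbrev Zs (n : ℕ) : Type := (Fin n → ℝ) × (Fin n → ℝ)

/-- Squared Euclidean norm. -/
def qf {n : ℕ} (z : Zs n) : ℝ := ∑ i, ((z.1 i) ^ 2 + (z.2 i) ^ 2)

/-- Euclidean inner product. -/
def ipz {n : ℕ} (z v : Zs n) : ℝ := ∑ i, (z.1 i * v.1 i + z.2 i * v.2 i)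

/-- The point of the Heisenberg group over `z` at height `t`. -/
def emb {n : ℕ} (z : Zs n) (t : ℝ) : Hei n := (z.1, z.2, t)

/-- The height of the Pansu ball over `z`. -/
def Uf {n : ℕ} (lam : ℝ) (z : Zs n) : ℝ := pansuProfile lam (zNorm2 z)

/-- The area density. -/
def Wf {n : ℕ} (lam : ℝ) (z : Zs n) : ℝ := zNorm2 z * (√(1 - lam ^ 2 * zNorm2 z ^ 2))⁻¹

lemma zNorm2_eq {n : ℕ} (z : Zs n) : zNorm2 z = √(qf z) := rfl

lemma qf_nonneg {n : ℕ} (z : Zs n) : 0 ≤ qf z := by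
  unfold qf; positivity

lemma zNorm2_sq {n : ℕ} (z : Zs n) : zNorm2 z ^ 2 = qf z := Real.sq_sqrt (qf_nonneg z)

lemma zNorm2_nonneg {n : ℕ} (z : Zs n) : 0 ≤ zNorm2 z := Real.sqrt_nonneg _

lemma abs_fst_le {n : ℕ} (z : Zs n) (i : Fin n) : |z.1 i| ≤ zNorm2 z := by
  rw [zNorm2_eq]
  apply Real.abs_le_sqrt
  unfold qf
  refine le_trans ?_ (Finset.single_le_sum (f := fun i => (z.1 i) ^ 2 + (z.2 i) ^ 2)
    (fun j _ => by positivity) (Finset.mem_univ i))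
  nlinarith [sq_nonneg (z.2 i)]

lemma abs_snd_le {n : ℕ} (z : Zs n) (i : Fin n) : |z.2 i| ≤ zNorm2 z := by
  rw [zNorm2_eq]
  apply Real.abs_le_sqrt
  unfold qf
  refine le_trans ?_ (Finset.single_le_sum (f := fun i => (z.1 i) ^ 2 + (z.2 i) ^ 2)
    (fun j _ => by positivity) (Finset.mem_univ i))
  nlinarith [sq_nonneg (z.1 i)]

lemma norm_le_zNorm2 {n : ℕ} (z : Zs n) : ‖z‖ ≤ zNorm2 z := by
  rw [Prod.norm_def]
  refine max_le ?_ ?_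
  · exact (pi_norm_le_iff_of_nonneg (zNorm2_nonneg z)).2 fun i => abs_fst_le z i
  · exact (pi_norm_le_iff_of_nonneg (zNorm2_nonneg z)).2 fun i => abs_snd_le z i

lemma contDiff_qf {n : ℕ} : ContDiff ℝ 1 (qf : Zs n → ℝ) := by
  unfold qf
  fun_prop

lemma continuous_qf {n : ℕ} : Continuous (qf : Zs n → ℝ) := contDiff_qf.continuous

lemma continuous_zNorm2 {n : ℕ} : Continuous (zNorm2 : Zs n → ℝ) :=
  Real.continuous_sqrt.comp continuous_qf

lemma fderiv_qf {n : ℕ} (z v : Zs n) : fderiv ℝ qf z v = 2 * ipz z v := by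
  have hd : DifferentiableAt ℝ (qf : Zs n → ℝ) z := contDiff_qf.differentiable (by simp) z
  rw [← hd.lineDeriv_eq_fderiv]
  refine HasLineDerivAt.lineDeriv ?_
  unfold HasLineDerivAt qf ipz
  have key : ∀ a b : ℝ, HasDerivAt (fun t : ℝ => (a + t * b) ^ 2) (2 * (a * b)) 0 := by
    intro a b
    have := (((hasDerivAt_id (0 : ℝ)).mul_const b).const_add a).pow 2
    refine (this.congr_deriv ?_)
    simp
    ring
  have : HasDerivAt (fun t : ℝ => ∑ i, ((z.1 i + t * v.1 i) ^ 2 + (z.2 i + t * v.2 i) ^ 2))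
      (∑ i, (2 * (z.1 i * v.1 i) + 2 * (z.2 i * v.2 i))) 0 :=
    HasDerivAt.fun_sum fun i _ => (key _ _).add (key _ _)
  refine this.congr_deriv ?_
  rw [Finset.mul_sum]
  exact Finset.sum_congr rfl fun i _ => by ring

lemma Uf_eq {n : ℕ} (lam : ℝ) (z : Zs n) : Uf lam z = gprof lam (qf z) := rfl

lemma continuous_Uf {n : ℕ} (lam : ℝ) : Continuous (Uf lam : Zs n → ℝ) :=
  (continuous_gprof lam).comp continuous_qf

lemma one_lt_of_not_mem {n : ℕ} {lam : ℝ} (hl : 0 < lam) {z : Zs n}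
    (hz : z ∉ Metric.closedBall (0 : Zs n) (1 / lam)) : 1 ≤ lam ^ 2 * qf z := by
  have h1 : 1 / lam < zNorm2 z := by
    refine lt_of_lt_of_le ?_ (norm_le_zNorm2 z)
    simpa using hz
  rw [div_lt_iff₀ hl] at h1
  rw [← zNorm2_sq]
  nlinarith

lemma hasCompactSupport_Uf {n : ℕ} {lam : ℝ} (hl : 0 < lam) :
    HasCompactSupport (Uf lam : Zs n → ℝ) :=
  HasCompactSupport.intro (isCompact_closedBall (0 : Zs n) (1 / lam))
    fun _ hz => gprof_of_ge hl (one_lt_of_not_mem hl hz)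

lemma integrable_Uf {n : ℕ} {lam : ℝ} (hl : 0 < lam) : Integrable (Uf lam : Zs n → ℝ) :=
  (continuous_Uf lam).integrable_of_hasCompactSupport (hasCompactSupport_Uf hl)

/-- The truncated height functions. -/
def uk {n : ℕ} (lam : ℝ) (k : ℕ) (z : Zs n) : ℝ := Phi lam (cseq k) (qf z)

lemma contDiff_uk {n : ℕ} {lam : ℝ} (hl : 0 < lam) (k : ℕ) :
    ContDiff ℝ 1 (uk lam k : Zs n → ℝ) :=
  (contDiff_Phi hl (cseq_pos k)).comp contDiff_qf

lemma hasCompactSupport_uk {n : ℕ} {lam : ℝ} (hl : 0 < lam) (k : ℕ) :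
    HasCompactSupport (uk lam k : Zs n → ℝ) :=
  HasCompactSupport.intro (isCompact_closedBall (0 : Zs n) (1 / lam)) fun z hz => by
    have := gprof_of_ge hl (one_lt_of_not_mem hl hz)
    simp [uk, Phi, this, phi_of_le (cseq_pos k).le]

lemma fderiv_uk {n : ℕ} {lam : ℝ} (hl : 0 < lam) (k : ℕ) (z v : Zs n) :
    fderiv ℝ (uk lam k) z v = dPhi lam (cseq k) (qf z) * (2 * ipz z v) := by
  have hd : DifferentiableAt ℝ (qf : Zs n → ℝ) z := contDiff_qf.differentiable (by simp) z
  have := (hasDerivAt_Phi hl (cseq_pos k) (qf z)).comp_hasFDerivAt z hd.hasFDerivAt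
  have h2 : fderiv ℝ (uk lam k) z = dPhi lam (cseq k) (qf z) • fderiv ℝ qf z := this.fderiv
  rw [h2]
  simp [fderiv_qf]

lemma uk_nonneg {n : ℕ} (lam : ℝ) (k : ℕ) (z : Zs n) : 0 ≤ uk lam k z :=
  phi_nonneg (cseq_pos k) _

lemma uk_le {n : ℕ} {lam : ℝ} (hl : 0 < lam) (k : ℕ) (z : Zs n) : uk lam k z ≤ Uf lam z :=
  phi_le (cseq_pos k) (gprof_nonneg hl _)

lemma tendsto_uk {n : ℕ} {lam : ℝ} (hl : 0 < lam) (z : Zs n) :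
    Tendsto (fun k => uk lam k z) atTop (𝓝 (Uf lam z)) :=
  tendsto_phi (gprof_nonneg hl _)

/-- The derivative of `Uf lam` in direction `v`. -/
def dU {n : ℕ} (lam : ℝ) (z v : Zs n) : ℝ := dgprof lam (qf z) * (2 * ipz z v)

lemma dU_eq {n : ℕ} (lam : ℝ) (z v : Zs n) : dU lam z v = -(lam * Wf lam z * ipz z v) := by
  unfold dU dgprof Wf
  rw [← zNorm2_eq]
  generalize √(1 - lam ^ 2 * zNorm2 z ^ 2) = S
  rw [div_eq_mul_inv, mul_inv]
  ring

lemma Wf_of_ge {n : ℕ} {lam : ℝ} {z : Zs n} (h : 1 ≤ lam ^ 2 * qf z) : Wf lam z = 0 := by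
  unfold Wf
  rw [zNorm2_sq, Real.sqrt_eq_zero_of_nonpos (show 1 - lam ^ 2 * qf z ≤ 0 by linarith)]
  simp

lemma Wf_nonneg {n : ℕ} (lam : ℝ) (z : Zs n) : 0 ≤ Wf lam z :=
  mul_nonneg (zNorm2_nonneg z) (inv_nonneg.2 (Real.sqrt_nonneg _))

lemma abs_dU_le {n : ℕ} {lam : ℝ} (hl : 0 < lam) {z v : Zs n} (hv : |ipz z v| ≤ zNorm2 z) :
    |dU lam z v| ≤ Wf lam z := by
  rw [dU_eq]
  rcases lt_or_ge (lam ^ 2 * qf z) 1 with h | h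
  · have h1 : lam * zNorm2 z < 1 := lam_sqrt_lt_one hl h
    rw [abs_neg, abs_mul, abs_of_nonneg (mul_nonneg hl.le (Wf_nonneg lam z))]
    calc lam * Wf lam z * |ipz z v| ≤ lam * Wf lam z * zNorm2 z :=
          mul_le_mul_of_nonneg_left hv (mul_nonneg hl.le (Wf_nonneg lam z))
      _ = Wf lam z * (lam * zNorm2 z) := by ring
      _ ≤ Wf lam z * 1 := mul_le_mul_of_nonneg_left h1.le (Wf_nonneg lam z)
      _ = Wf lam z := mul_one _
  · simp [Wf_of_ge h]

/-! ### Integrability of the area density -/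

lemma integrable_radial {lam : ℝ} (hl : 0 < lam) (d : ℕ) :
    IntegrableOn (fun r : ℝ => r ^ d • (r * (√(1 - lam ^ 2 * r ^ 2))⁻¹)) (Ioi 0) := by
  have h1 : IntegrableOn (fun r : ℝ => r * (√(1 - lam ^ 2 * r ^ 2))⁻¹) (Ioc 0 (1 / lam)) := by
    refine intervalIntegral.integrableOn_deriv_of_nonneg
      (g := fun r => -(1 / lam ^ 2) * √(1 - lam ^ 2 * r ^ 2)) (by fun_prop) ?_ ?_
    · intro r hr
      have h0 : lam * r < 1 := by
        have := hr.2
        rw [lt_div_iff₀ hl] at this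
        linarith
      have hpos : 0 < 1 - lam ^ 2 * r ^ 2 := by
        have : 0 < lam * r := mul_pos hl hr.1
        nlinarith
      have e2 : HasDerivAt (fun ρ : ℝ => 1 - lam ^ 2 * ρ ^ 2) (-(lam ^ 2 * (2 * r))) r := by
        simpa using ((hasDerivAt_pow 2 r).const_mul (lam ^ 2)).const_sub 1
      refine ((e2.sqrt hpos.ne').const_mul (-(1 / lam ^ 2))).congr_deriv ?_
      have := Real.sqrt_pos.2 hpos
      field_simp
    · intro r hr
      exact mul_nonneg hr.1.le (inv_nonneg.2 (Real.sqrt_nonneg _))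
  have h2 : IntegrableOn (fun r : ℝ => r ^ d • (r * (√(1 - lam ^ 2 * r ^ 2))⁻¹))
      (Ioc 0 (1 / lam)) := by
    refine Integrable.bdd_mul (c := (1 / lam) ^ d) h1 (by fun_prop) ?_
    refine (ae_restrict_iff' measurableSet_Ioc).2 (Eventually.of_forall fun r hr => ?_)
    rw [norm_pow, Real.norm_of_nonneg hr.1.le]
    exact pow_le_pow_left₀ hr.1.le hr.2 d
  refine h2.of_forall_sdiff_eq_zero measurableSet_Ioi ?_
  intro r hr
  have h3 : 1 / lam < r := by
    by_contra h
    exact hr.2 ⟨hr.1, not_lt.1 h⟩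
  rw [div_lt_iff₀ hl] at h3
  have h4 : 1 - lam ^ 2 * r ^ 2 ≤ 0 := by nlinarith
  simp [Real.sqrt_eq_zero_of_nonpos h4]

/-- Identification of the horizontal space with a Euclidean space. -/
def toEuc (n : ℕ) : Zs n ≃L[ℝ] EuclideanSpace ℝ (Fin n ⊕ Fin n) :=
  ((LinearEquiv.sumArrowLequivProdArrow (Fin n) (Fin n) ℝ ℝ).symm.trans
    (WithLp.linearEquiv 2 ℝ (Fin n ⊕ Fin n → ℝ)).symm).toContinuousLinearEquiv

lemma norm_toEuc {n : ℕ} (z : Zs n) : ‖toEuc n z‖ = zNorm2 z := by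
  rw [EuclideanSpace.norm_eq, zNorm2_eq, qf, Fintype.sum_sum_type, Finset.sum_add_distrib]
  simp [toEuc]
  rfl

instance instHaarZs (n : ℕ) : (volume : Measure (Zs n)).IsAddHaarMeasure :=
  Measure.prod.instIsAddHaarMeasure _ _

lemma integrable_Wf {n : ℕ} (hn : 1 ≤ n) {lam : ℝ} (hl : 0 < lam) :
    Integrable (Wf lam : Zs n → ℝ) := by
  have : Nonempty (Fin n) := ⟨⟨0, hn⟩⟩
  have : (Measure.map (toEuc n) (volume : Measure (Zs n))).IsAddHaarMeasure :=
    (toEuc n).isAddHaarMeasure_map _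
  have h := (integrable_fun_norm_addHaar (Measure.map (toEuc n) (volume : Measure (Zs n)))
    (f := fun r : ℝ => r * (√(1 - lam ^ 2 * r ^ 2))⁻¹)).2 (integrable_radial hl _)
  have h2 := ((toEuc n).toHomeomorph.measurableEmbedding.integrable_map_iff).1 h
  refine h2.congr (Eventually.of_forall fun z => ?_)
  simp [Wf, norm_toEuc]

/-! ### Integration by parts -/

lemma contDiff_emb_comp {n : ℕ} {X : Type*} [NormedAddCommGroup X] [NormedSpace ℝ X]
    {f : X → Zs n} {g : X → ℝ} (hf : ContDiff ℝ 1 f) (hg : ContDiff ℝ 1 g) :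
    ContDiff ℝ 1 (fun x => emb (f x) (g x)) := by
  unfold emb
  fun_prop

lemma continuous_emb_comp {n : ℕ} {X : Type*} [TopologicalSpace X]
    {f : X → Zs n} {g : X → ℝ} (hf : Continuous f) (hg : Continuous g) :
    Continuous (fun x => emb (f x) (g x)) := by
  unfold emb
  fun_prop

lemma integral_fderiv_zero {n : ℕ} {G : Zs n → ℝ} (hG : ContDiff ℝ 1 G)
    (hc : HasCompactSupport G) (v : Zs n) : ∫ z, fderiv ℝ G z v = 0 := by
  have hi : Integrable (fun z => fderiv ℝ G z v) :=
    ((hG.continuous_fderiv (by simp)).clm_apply continuous_const).integrable_of_hasCompactSupport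
      (hc.fderiv_apply ℝ v)
  have h := integral_mul_fderiv_eq_neg_fderiv_mul_of_integrable (μ := (volume : Measure (Zs n)))
    (f := fun _ : Zs n => (1 : ℝ)) (g := G) (v := v) (by simp) (by simpa using hi)
    (by simpa using hG.continuous.integrable_of_hasCompactSupport hc)
    (fun x _ => by fun_prop) (fun x _ => hG.differentiable (by simp) x)
  simpa using h

lemma continuous_symm_integral {X : Type*} [TopologicalSpace X] {f : X → ℝ → ℝ} {s : X → ℝ}
    (hf : Continuous (Function.uncurry f)) (hs : Continuous s) :
    Continuous fun x => ∫ t in (-s x)..(s x), f x t := by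
  have h1 : ∀ x, ∫ t in (-s x)..(s x), f x t =
      (∫ t in (0 : ℝ)..(s x), f x t) - ∫ t in (0 : ℝ)..(-s x), f x t := by
    intro x
    have hfx : Continuous (f x) := hf.comp (by fun_prop : Continuous fun t => (x, t))
    rw [intervalIntegral.integral_interval_sub_left (hfx.intervalIntegrable _ _)
      (hfx.intervalIntegrable _ _)]
  simp_rw [h1]
  exact (intervalIntegral.continuous_parametric_intervalIntegral_of_continuous hf hs).sub
    (intervalIntegral.continuous_parametric_intervalIntegral_of_continuous hf hs.neg)

lemma fderiv_curve {n : ℕ} {ψ : Hei n → ℝ} (hψ : ContDiff ℝ 1 ψ) {u : Zs n → ℝ}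
    (hu : ContDiff ℝ 1 u) (s : ℝ) (z v : Zs n) :
    fderiv ℝ (fun z => ψ (emb z (s * u z)) * u z) z v =
      u z * fderiv ℝ ψ (emb z (u z * s)) (v.1, v.2, 0)
        + fderiv ℝ u z v * (s * (u z * fderiv ℝ ψ (emb z (u z * s)) (0, 0, 1))
          + ψ (emb z (u z * s))) := by
  have hdu : HasFDerivAt u (fderiv ℝ u z) z := (hu.differentiable (by simp) z).hasFDerivAt
  have h1 : HasFDerivAt (fun z : Zs n => emb z (s * u z))
      ((ContinuousLinearMap.fst ℝ _ _).prod
        ((ContinuousLinearMap.snd ℝ _ _).prod (s • fderiv ℝ u z))) z := by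
    unfold emb
    exact hasFDerivAt_fst.prodMk (hasFDerivAt_snd.prodMk (hdu.const_mul s))
  have h2 : HasFDerivAt ψ (fderiv ℝ ψ (emb z (s * u z))) (emb z (s * u z)) :=
    (hψ.differentiable (by simp) _).hasFDerivAt
  have h3 := (h2.comp z h1).mul hdu
  have h4 := h3.fderiv
  simp only [Function.comp_def] at h4
  erw [h4]
  have h5 : ((v.1, v.2, s * fderiv ℝ u z v) : Hei n)
      = (v.1, v.2, 0) + (s * fderiv ℝ u z v) • ((0, 0, 1) : Hei n) := by
    simp
  simp only [add_apply, smul_apply,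
    ContinuousLinearMap.comp_apply, ContinuousLinearMap.prod_apply, ContinuousLinearMap.coe_fst',
    ContinuousLinearMap.coe_snd', smul_eq_mul]
  rw [h5, map_add, map_smul, smul_eq_mul, mul_comm s (u z)]
  ring

lemma ibp {n : ℕ} {ψ : Hei n → ℝ} (hψ : ContDiff ℝ 1 ψ) {u : Zs n → ℝ}
    (hu : ContDiff ℝ 1 u) (hcu : HasCompactSupport u) (v : Zs n) :
    ∫ z, ∫ t in (-u z)..(u z), fderiv ℝ ψ (emb z t) (v.1, v.2, 0)
      = -∫ z, fderiv ℝ u z v * (ψ (emb z (u z)) + ψ (emb z (-u z))) := by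
  set L : ℝ → Zs n → ℝ := fun s z => u z * fderiv ℝ ψ (emb z (u z * s)) (v.1, v.2, 0)
        + fderiv ℝ u z v * (s * (u z * fderiv ℝ ψ (emb z (u z * s)) (0, 0, 1))
          + ψ (emb z (u z * s))) with hL
  have hψc := hψ.continuous
  have huc := hu.continuous
  have hdψ : Continuous (fderiv ℝ ψ) := hψ.continuous_fderiv (by simp)
  have hdu : Continuous (fderiv ℝ u) := hu.continuous_fderiv (by simp)
  have hdduv : Continuous fun z => fderiv ℝ u z v := hdu.clm_apply continuous_const
  have hemb : Continuous fun p : ℝ × Zs n => emb p.2 (u p.2 * p.1) :=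
    continuous_emb_comp (by fun_prop) (by fun_prop)
  have hLc : Continuous (Function.uncurry L) := by
    have e1 : Continuous fun p : ℝ × Zs n =>
        fderiv ℝ ψ (emb p.2 (u p.2 * p.1)) (v.1, v.2, 0) :=
      (hdψ.comp hemb).clm_apply continuous_const
    have e2 : Continuous fun p : ℝ × Zs n =>
        fderiv ℝ ψ (emb p.2 (u p.2 * p.1)) (0, 0, 1) :=
      (hdψ.comp hemb).clm_apply continuous_const
    have e3 : Continuous fun p : ℝ × Zs n => ψ (emb p.2 (u p.2 * p.1)) := hψc.comp hemb
    have e4 : Continuous fun p : ℝ × Zs n => fderiv ℝ u p.2 v := hdduv.comp continuous_snd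
    have e5 : Continuous fun p : ℝ × Zs n => u p.2 := huc.comp continuous_snd
    exact (e5.mul e1).add (e4.mul ((continuous_fst.mul (e5.mul e2)).add e3))
  have hu0 : ∀ z ∉ tsupport u, u z = 0 := fun z hz => image_eq_zero_of_notMem_tsupport hz
  have hdu0 : ∀ z ∉ tsupport u, fderiv ℝ u z = 0 := fun z hz =>
    fderiv_of_notMem_tsupport ℝ hz
  have hL0 : ∀ s, ∫ z, L s z = 0 := by
    intro s
    have hG : ContDiff ℝ 1 (fun z => ψ (emb z (s * u z)) * u z) :=
      (hψ.comp (contDiff_emb_comp contDiff_id (contDiff_const.mul hu))).mul hu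
    have := integral_fderiv_zero hG (HasCompactSupport.mul_left hcu) v
    rw [← this]
    refine integral_congr_ae (Eventually.of_forall fun z => ?_)
    simp only [hL]
    rw [fderiv_curve hψ hu]
  have hLi : Integrable (Function.uncurry L)
      ((volume.restrict (Set.uIoc (-1 : ℝ) 1)).prod (volume : Measure (Zs n))) := by
    have e1 : IntegrableOn (Function.uncurry L) (Icc (-1 : ℝ) 1 ×ˢ tsupport u)
        (volume.prod volume) :=
      hLc.continuousOn.integrableOn_compact (isCompact_Icc.prod hcu)
    have e2 : IntegrableOn (Function.uncurry L) (Set.uIoc (-1 : ℝ) 1 ×ˢ univ)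
        (volume.prod volume) := by
      refine e1.of_forall_sdiff_eq_zero (measurableSet_uIoc.prod MeasurableSet.univ) ?_
      rintro ⟨s, z⟩ ⟨h1, h2⟩
      have hz : z ∉ tsupport u := by
        intro hz
        apply h2
        refine ⟨?_, hz⟩
        have := h1.1
        rw [Set.uIoc_of_le (by norm_num)] at this
        exact Ioc_subset_Icc_self this
      simp [hL, hu0 z hz, hdu0 z hz]
    rw [IntegrableOn, ← Measure.prod_restrict, Measure.restrict_univ] at e2
    exact e2
  have hswap := intervalIntegral_integral_swap hLi
  simp_rw [hL0] at hswap
  rw [intervalIntegral.integral_zero] at hswap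
  have hinner : ∀ z, ∫ s in (-1 : ℝ)..1, L s z =
      (∫ t in (-u z)..(u z), fderiv ℝ ψ (emb z t) (v.1, v.2, 0))
      + fderiv ℝ u z v * (ψ (emb z (u z)) + ψ (emb z (-u z))) := by
    intro z
    have hembz : Continuous fun s : ℝ => emb z (u z * s) :=
      continuous_emb_comp (by fun_prop) (by fun_prop)
    have c1 : Continuous fun s : ℝ => fderiv ℝ ψ (emb z (u z * s)) (v.1, v.2, 0) :=
      (hdψ.comp hembz).clm_apply continuous_const
    have c2 : Continuous fun s : ℝ => fderiv ℝ ψ (emb z (u z * s)) (0, 0, 1) :=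
      (hdψ.comp hembz).clm_apply continuous_const
    have c3 : Continuous fun s : ℝ => ψ (emb z (u z * s)) := hψc.comp hembz
    have c4 : Continuous fun s : ℝ => (s * (u z * fderiv ℝ ψ (emb z (u z * s)) (0, 0, 1))
          + ψ (emb z (u z * s))) := by fun_prop
    simp only [hL]
    rw [intervalIntegral.integral_add ((c1.const_mul _).intervalIntegrable _ _)
      ((c4.const_mul _).intervalIntegrable _ _), intervalIntegral.integral_const_mul,
      intervalIntegral.integral_const_mul]
    congr 1
    · have := intervalIntegral.smul_integral_comp_mul_left (a := (-1 : ℝ)) (b := 1)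
        (fun t => fderiv ℝ ψ (emb z t) (v.1, v.2, 0)) (u z)
      simpa using this
    · congr 1
      have hd : ∀ s ∈ Set.uIcc (-1 : ℝ) 1, HasDerivAt (fun s : ℝ => s * ψ (emb z (u z * s)))
          (s * (u z * fderiv ℝ ψ (emb z (u z * s)) (0, 0, 1)) + ψ (emb z (u z * s))) s := by
        intro s _
        have d1 : HasDerivAt (fun s : ℝ => emb z (u z * s)) ((0, 0, u z) : Hei n) s := by
          unfold emb
          refine (hasDerivAt_const s z.1).prodMk ((hasDerivAt_const s z.2).prodMk ?_)
          simpa using (hasDerivAt_id s).const_mul (u z)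
        have d2 : HasFDerivAt ψ (fderiv ℝ ψ (emb z (u z * s))) (emb z (u z * s)) :=
          (hψ.differentiable (by simp) _).hasFDerivAt
        have d3 := (hasDerivAt_id s).mul (d2.comp_hasDerivAt s d1)
        refine d3.congr_deriv ?_
        have h5 : ((0, 0, u z) : Hei n) = (u z) • ((0, 0, 1) : Hei n) := by simp
        rw [h5, map_smul]
        simp
        ring
      rw [intervalIntegral.integral_eq_sub_of_hasDerivAt hd (c4.intervalIntegrable _ _)]
      simp
  simp_rw [hinner] at hswap
  have i1 : Integrable (fun z => fderiv ℝ u z v * (ψ (emb z (u z)) + ψ (emb z (-u z)))) := by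
    refine Continuous.integrable_of_hasCompactSupport ?_ ?_
    · exact hdduv.mul ((hψc.comp (continuous_emb_comp continuous_id huc)).add
        (hψc.comp (continuous_emb_comp continuous_id huc.neg)))
    · exact HasCompactSupport.mul_right (hcu.fderiv_apply ℝ v)
  have i2 : Integrable (fun z => ∫ t in (-u z)..(u z),
      fderiv ℝ ψ (emb z t) (v.1, v.2, 0)) := by
    refine Continuous.integrable_of_hasCompactSupport ?_ ?_
    · refine continuous_symm_integral ?_ huc
      exact (hdψ.comp (continuous_emb_comp continuous_fst continuous_snd)).clm_apply
        continuous_const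
    · refine HasCompactSupport.intro hcu fun z hz => ?_
      simp [hu0 z hz]
  rw [integral_add i2 i1] at hswap
  linarith

/-! ### Flux formula for the Pansu ball -/

lemma continuous_zNorm {n : ℕ} : Continuous (zNorm : Hei n → ℝ) := by
  unfold zNorm
  fun_prop

lemma measurableSet_pansuBall (n : ℕ) (lam : ℝ) : MeasurableSet (pansuBall n lam) := by
  have h1 : Continuous fun p : Hei n => pansuProfile lam (zNorm p) := by
    unfold pansuProfile
    have := Real.continuous_arccos
    have := continuous_zNorm (n := n)
    fun_prop
  have h2 : IsClosed (pansuBall n lam) :=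
    (isClosed_le continuous_zNorm continuous_const).inter
      (isClosed_le (by fun_prop) h1)
  exact h2.measurableSet

lemma integral_pansuBall {n : ℕ} {lam : ℝ} (hl : 0 < lam) {ψ : Hei n → ℝ}
    (hψ : Integrable ψ) :
    ∫ p in pansuBall n lam, ψ p = ∫ z : Zs n, ∫ t in (-Uf lam z)..(Uf lam z), ψ (emb z t) := by
  have hm := measurableSet_pansuBall n lam
  rw [← integral_indicator hm]
  have hpres : MeasurePreserving
      (MeasurableEquiv.prodAssoc : ((Fin n → ℝ) × (Fin n → ℝ)) × ℝ ≃ᵐ Hei n) volume volume :=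
    volume_preserving_prodAssoc
  rw [← hpres.integral_comp' (g := (pansuBall n lam).indicator ψ)]
  have hi : Integrable (fun w : Zs n × ℝ => (pansuBall n lam).indicator ψ
      (MeasurableEquiv.prodAssoc w)) (volume.prod volume) :=
    hpres.integrable_comp_of_integrable (hψ.indicator hm)
  have h3 := integral_prod _ hi
  refine h3.trans ?_
  refine integral_congr_ae (Eventually.of_forall fun z => ?_)
  have hU : 0 ≤ Uf lam z := gprof_nonneg hl _
  show ∫ t, (pansuBall n lam).indicator ψ (emb z t) = _
  by_cases hz : zNorm2 z ≤ 1 / lam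
  · have h4 : ∀ t, (pansuBall n lam).indicator ψ (emb z t)
        = (Icc (-Uf lam z) (Uf lam z)).indicator (fun t => ψ (emb z t)) t := by
      intro t
      have : emb z t ∈ pansuBall n lam ↔ t ∈ Icc (-Uf lam z) (Uf lam z) := by
        rw [mem_Icc, ← abs_le]
        exact ⟨fun h => h.2, fun h => ⟨hz, h⟩⟩
      by_cases ht : t ∈ Icc (-Uf lam z) (Uf lam z)
      · rw [indicator_of_mem ht, indicator_of_mem (this.2 ht)]
      · rw [indicator_of_notMem ht, indicator_of_notMem (fun h => ht (this.1 h))]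
    simp_rw [h4]
    rw [integral_indicator measurableSet_Icc, integral_Icc_eq_integral_Ioc,
      intervalIntegral.integral_of_le (by linarith)]
  · have h5 : ∀ t, (pansuBall n lam).indicator ψ (emb z t) = 0 := by
      intro t
      exact indicator_of_notMem (fun h => hz h.1) _
    have h6 : Uf lam z = 0 := by
      have h7 : 1 ≤ lam ^ 2 * qf z := by
        rw [← zNorm2_sq]
        push Not at hz
        rw [div_lt_iff₀ hl] at hz
        nlinarith
      exact gprof_of_ge hl h7
    simp [h5, h6]

section flux

variable {n : ℕ} {lam : ℝ} {ψ : Hei n → ℝ}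

lemma bound_comp (hψ : ContDiff ℝ 1 ψ) (hcψ : HasCompactSupport ψ) :
    ∃ C, 0 ≤ C ∧ ∀ p, |ψ p| ≤ C := by
  obtain ⟨C, hC⟩ := hψ.continuous.bounded_above_of_compact_support hcψ
  exact ⟨C, (norm_nonneg _).trans (hC 0), hC⟩

lemma integrable_flux1 (hn : 1 ≤ n) (hl : 0 < lam) (hψ : ContDiff ℝ 1 ψ)
    (hcψ : HasCompactSupport ψ) {v : Zs n} (hv : ∀ z, |ipz z v| ≤ zNorm2 z) :
    Integrable (fun z => dU lam z v * (ψ (emb z (Uf lam z)) + ψ (emb z (-Uf lam z)))) := by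
  obtain ⟨C, hC0, hC⟩ := bound_comp hψ hcψ
  have hi := integrable_Wf hn hl
  refine (hi.mul_const (2 * C)).mono' ?_ (Eventually.of_forall fun z => ?_)
  · have c1 : Continuous fun z => ψ (emb z (Uf lam z)) + ψ (emb z (-Uf lam z)) :=
      (hψ.continuous.comp (continuous_emb_comp continuous_id (continuous_Uf lam))).add
        (hψ.continuous.comp (continuous_emb_comp continuous_id (continuous_Uf lam).neg))
    have c2 : Continuous fun z : Zs n => ipz z v := by
      unfold ipz
      fun_prop
    simp_rw [dU_eq]
    exact ((hi.aestronglyMeasurable.const_mul lam).mul c2.aestronglyMeasurable).neg.mul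
      c1.aestronglyMeasurable
  · rw [norm_mul]
    refine mul_le_mul (abs_dU_le hl (hv z)) ?_ (norm_nonneg _) (Wf_nonneg _ _)
    refine (norm_add_le _ _).trans ?_
    have := hC (emb z (Uf lam z))
    have := hC (emb z (-Uf lam z))
    simp only [Real.norm_eq_abs]
    linarith

lemma integrable_flux2 (hl : 0 < lam) (hψ : ContDiff ℝ 1 ψ) {w : Zs n → ℝ}
    (hw : Continuous w) :
    Integrable (fun z => w z * (ψ (emb z (Uf lam z)) - ψ (emb z (-Uf lam z)))) := by
  refine Continuous.integrable_of_hasCompactSupport ?_ ?_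
  · exact hw.mul
      ((hψ.continuous.comp (continuous_emb_comp continuous_id (continuous_Uf lam))).sub
        (hψ.continuous.comp (continuous_emb_comp continuous_id (continuous_Uf lam).neg)))
  · refine HasCompactSupport.intro (hasCompactSupport_Uf hl) fun z hz => ?_
    have : Uf lam z = 0 := image_eq_zero_of_notMem_tsupport hz
    simp [this]

lemma integrable_fderiv_dir (hψ : ContDiff ℝ 1 ψ) (hcψ : HasCompactSupport ψ) (e : Hei n) :
    Integrable (fun p => fderiv ℝ ψ p e) := by
  have : (volume : Measure (Hei n)).IsAddHaarMeasure := by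
    have : (volume : Measure ((Fin n → ℝ) × ℝ)).IsAddHaarMeasure :=
      Measure.prod.instIsAddHaarMeasure _ _
    exact Measure.prod.instIsAddHaarMeasure _ _
  exact ((hψ.continuous_fderiv (by simp)).clm_apply
    continuous_const).integrable_of_hasCompactSupport (hcψ.fderiv_apply ℝ e)

lemma flux1 (hn : 1 ≤ n) (hl : 0 < lam) (hψ : ContDiff ℝ 1 ψ)
    (hcψ : HasCompactSupport ψ) {v : Zs n} (hv : ∀ z, |ipz z v| ≤ zNorm2 z) :
    ∫ p in pansuBall n lam, fderiv ℝ ψ p (v.1, v.2, 0)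
      = -∫ z, dU lam z v * (ψ (emb z (Uf lam z)) + ψ (emb z (-Uf lam z))) := by
  rw [integral_pansuBall hl (integrable_fderiv_dir hψ hcψ _)]
  obtain ⟨C, hC0, hC⟩ := bound_comp hψ hcψ
  have hdc : Continuous fun p => fderiv ℝ ψ p (v.1, v.2, 0) :=
    (hψ.continuous_fderiv (by simp)).clm_apply continuous_const
  obtain ⟨M, hM⟩ := hdc.bounded_above_of_compact_support (hcψ.fderiv_apply ℝ _)
  have hdce : Continuous (Function.uncurry
      fun (z : Zs n) (t : ℝ) => fderiv ℝ ψ (emb z t) (v.1, v.2, 0)) :=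
    hdc.comp (continuous_emb_comp continuous_fst continuous_snd)
  have hM0 : 0 ≤ M := (norm_nonneg _).trans (hM 0)
  have T1 : Tendsto (fun k => ∫ z : Zs n, ∫ t in (-uk lam k z)..(uk lam k z),
      fderiv ℝ ψ (emb z t) (v.1, v.2, 0)) atTop
      (𝓝 (∫ z : Zs n, ∫ t in (-Uf lam z)..(Uf lam z), fderiv ℝ ψ (emb z t) (v.1, v.2, 0))) := by
    refine tendsto_integral_of_dominated_convergence (fun z => M * (2 * Uf lam z)) ?_
      (((integrable_Uf hl).const_mul 2).const_mul M) ?_ ?_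
    · intro k
      exact (continuous_symm_integral hdce (contDiff_uk hl k).continuous).aestronglyMeasurable
    · refine fun k => Eventually.of_forall fun z => ?_
      refine (intervalIntegral.norm_integral_le_of_norm_le_const (fun t _ => hM _)).trans ?_
      have h1 := uk_nonneg lam k z
      have h2 := uk_le hl k z
      rw [abs_of_nonneg (by linarith)]
      exact mul_le_mul_of_nonneg_left (by linarith) hM0
    · refine Eventually.of_forall fun z => ?_
      have hc : Continuous fun r : ℝ => ∫ t in (-r)..r, fderiv ℝ ψ (emb z t) (v.1, v.2, 0) :=
        continuous_symm_integral (f := fun (_ : ℝ) t => fderiv ℝ ψ (emb z t) (v.1, v.2, 0))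
          (hdc.comp (continuous_emb_comp continuous_const continuous_snd)) continuous_id
      exact (hc.tendsto _).comp (tendsto_uk hl z)
  have T2 : Tendsto (fun k => -∫ z : Zs n, fderiv ℝ (uk lam k) z v *
        (ψ (emb z (uk lam k z)) + ψ (emb z (-uk lam k z)))) atTop
      (𝓝 (-∫ z, dU lam z v * (ψ (emb z (Uf lam z)) + ψ (emb z (-Uf lam z))))) := by
    refine Tendsto.neg ?_
    refine tendsto_integral_of_dominated_convergence (fun z => Wf lam z * (2 * C)) ?_
      ((integrable_Wf hn hl).mul_const _) ?_ ?_
    · intro k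
      have hc := (contDiff_uk (n := n) hl k).continuous
      have h1 : Continuous fun z => fderiv ℝ (uk lam k) z v :=
        ((contDiff_uk (n := n) hl k).continuous_fderiv (by simp)).clm_apply continuous_const
      exact (h1.mul ((hψ.continuous.comp (continuous_emb_comp continuous_id hc)).add
        (hψ.continuous.comp (continuous_emb_comp continuous_id hc.neg)))).aestronglyMeasurable
    · refine fun k => Eventually.of_forall fun z => ?_
      rw [norm_mul]
      refine mul_le_mul ?_ ?_ (norm_nonneg _) (Wf_nonneg _ _)
      · refine le_trans ?_ (abs_dU_le hl (hv z))
        rw [fderiv_uk hl, dU, dPhi, mul_assoc, norm_mul, Real.norm_eq_abs, Real.norm_eq_abs,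
          abs_of_nonneg (dphi_nonneg (cseq_pos k) _)]
        exact mul_le_of_le_one_left (abs_nonneg _) (dphi_le_one _ _)
      · refine (norm_add_le _ _).trans ?_
        have := hC (emb z (uk lam k z))
        have := hC (emb z (-uk lam k z))
        simp only [Real.norm_eq_abs]
        linarith
    · refine Eventually.of_forall fun z => ?_
      refine Tendsto.mul ?_ (Tendsto.add ?_ ?_)
      · simp_rw [fderiv_uk hl, dPhi, dU]
        rcases lt_or_ge (lam ^ 2 * qf z) 1 with h | h
        · have := ((tendsto_dphi (gprof_pos hl h)).mul_const (dgprof lam (qf z))).mul_const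
            (2 * ipz z v)
          simpa using this
        · simp [dgprof_of_ge h]
      · have hc : Continuous fun r : ℝ => ψ (emb z r) :=
          hψ.continuous.comp (continuous_emb_comp continuous_const continuous_id)
        exact (hc.tendsto _).comp (tendsto_uk hl z)
      · have hc : Continuous fun r : ℝ => ψ (emb z (-r)) :=
          hψ.continuous.comp (continuous_emb_comp continuous_const continuous_neg)
        exact (hc.tendsto _).comp (tendsto_uk hl z)
  refine tendsto_nhds_unique T1 (T2.congr fun k => ?_)
  exact (ibp hψ (contDiff_uk hl k) (hasCompactSupport_uk hl k) v).symm

lemma integrable_wt (hψ : ContDiff ℝ 1 ψ) (hcψ : HasCompactSupport ψ) {w : Zs n → ℝ}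
    (hw : Continuous w) :
    Integrable (fun p : Hei n => w (p.1, p.2.1) * fderiv ℝ ψ p (0, 0, 1)) := by
  have : (volume : Measure (Hei n)).IsAddHaarMeasure := by
    have : (volume : Measure ((Fin n → ℝ) × ℝ)).IsAddHaarMeasure :=
      Measure.prod.instIsAddHaarMeasure _ _
    exact Measure.prod.instIsAddHaarMeasure _ _
  have h1 : Continuous fun p : Hei n => fderiv ℝ ψ p (0, 0, 1) :=
    (hψ.continuous_fderiv (by simp)).clm_apply continuous_const
  refine Continuous.integrable_of_hasCompactSupport (by fun_prop) ?_
  exact HasCompactSupport.mul_left (hcψ.fderiv_apply ℝ _)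

lemma flux2 (hl : 0 < lam) (hψ : ContDiff ℝ 1 ψ)
    (hcψ : HasCompactSupport ψ) {w : Zs n → ℝ} (hw : Continuous w) :
    ∫ p in pansuBall n lam, w (p.1, p.2.1) * fderiv ℝ ψ p (0, 0, 1)
      = ∫ z, w z * (ψ (emb z (Uf lam z)) - ψ (emb z (-Uf lam z))) := by
  rw [integral_pansuBall hl (integrable_wt hψ hcψ hw)]
  refine integral_congr_ae (Eventually.of_forall fun z => ?_)
  have h0 : ∀ t, w ((emb z t).1, (emb z t).2.1) = w z := fun t => rfl
  simp only [h0]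
  rw [intervalIntegral.integral_const_mul]
  congr 1
  have hce : Continuous fun t : ℝ => emb z t :=
    continuous_emb_comp continuous_const continuous_id
  have hc : Continuous fun t => fderiv ℝ ψ (emb z t) (0, 0, 1) :=
    ((hψ.continuous_fderiv (by simp)).comp hce).clm_apply continuous_const
  refine intervalIntegral.integral_eq_sub_of_hasDerivAt (f := fun t => ψ (emb z t))
    (fun t _ => ?_) (hc.intervalIntegrable _ _)
  have d1 : HasDerivAt (fun s : ℝ => emb z s) ((0, 0, 1) : Hei n) t := by
    unfold emb
    exact (hasDerivAt_const t z.1).prodMk ((hasDerivAt_const t z.2).prodMk (hasDerivAt_id t))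
  have d2 : HasFDerivAt ψ (fderiv ℝ ψ (emb z t)) (emb z t) :=
    (hψ.differentiable (by simp) _).hasFDerivAt
  exact d2.comp_hasDerivAt t d1

/-- The boundary integrand of one component. -/
def fluxI (lam : ℝ) (ψ : Hei n → ℝ) (c w : ℝ) (z : Zs n) : ℝ :=
  lam * Wf lam z * c * (ψ (emb z (Uf lam z)) + ψ (emb z (-Uf lam z)))
    + w * (ψ (emb z (Uf lam z)) - ψ (emb z (-Uf lam z)))

lemma flux_all (hn : 1 ≤ n) (hl : 0 < lam) (hψ : ContDiff ℝ 1 ψ)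
    (hcψ : HasCompactSupport ψ) {v : Zs n} (hv : ∀ z, |ipz z v| ≤ zNorm2 z)
    {w : Zs n → ℝ} (hw : Continuous w) :
    Integrable (fun p : Hei n => fderiv ℝ ψ p (v.1, v.2, 0)
      + w (p.1, p.2.1) * fderiv ℝ ψ p (0, 0, 1)) ∧
    Integrable (fun z => fluxI lam ψ (ipz z v) (w z) z) ∧
    ∫ p in pansuBall n lam, (fderiv ℝ ψ p (v.1, v.2, 0)
      + w (p.1, p.2.1) * fderiv ℝ ψ p (0, 0, 1)) =
    ∫ z, fluxI lam ψ (ipz z v) (w z) z := by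
  have h1 := integrable_flux1 hn hl hψ hcψ hv
  have h2 := integrable_flux2 (lam := lam) hl hψ hw
  have e : ∀ z, fluxI lam ψ (ipz z v) (w z) z =
      -(dU lam z v * (ψ (emb z (Uf lam z)) + ψ (emb z (-Uf lam z))))
      + w z * (ψ (emb z (Uf lam z)) - ψ (emb z (-Uf lam z))) := by
    intro z
    rw [dU_eq, fluxI]
    ring
  have i1 := integrable_fderiv_dir hψ hcψ (v.1, v.2, 0)
  have i2 := integrable_wt hψ hcψ hw
  refine ⟨i1.add i2, ?_, ?_⟩
  · simp_rw [e]
    exact h1.neg.add h2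
  · simp_rw [e]
    have h1' : Integrable fun z =>
        -(dU lam z v * (ψ (emb z (Uf lam z)) + ψ (emb z (-Uf lam z)))) := h1.neg
    rw [integral_add i1.integrableOn i2.integrableOn, integral_add h1' h2, integral_neg,
      flux1 hn hl hψ hcψ hv, flux2 hl hψ hcψ hw]

end flux

/-- The total boundary integrand. -/
def fluxT {n : ℕ} (lam : ℝ) (a b : Hei n → Fin n → ℝ) (z : Zs n) : ℝ :=
  ∑ i, (fluxI lam (fun p => a p i) (z.1 i) (z.2 i) z
    + fluxI lam (fun p => b p i) (z.2 i) (-z.1 i) z)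

lemma flux_total {n : ℕ} {lam : ℝ} (hn : 1 ≤ n) (hl : 0 < lam) {a b : Hei n → Fin n → ℝ}
    (ha : ContDiff ℝ 1 a) (hb : ContDiff ℝ 1 b) (hca : HasCompactSupport a)
    (hcb : HasCompactSupport b) :
    Integrable (fluxT lam a b) ∧
    ∫ p in pansuBall n lam, hDivergence a b p = ∫ z, fluxT lam a b z := by
  have ha' : ∀ i, ContDiff ℝ 1 (fun p => a p i) := fun i => contDiff_pi.1 ha i
  have hb' : ∀ i, ContDiff ℝ 1 (fun p => b p i) := fun i => contDiff_pi.1 hb i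
  have hca' : ∀ i, HasCompactSupport (fun p => a p i) := fun i =>
    hca.comp_left (g := fun f : Fin n → ℝ => f i) rfl
  have hcb' : ∀ i, HasCompactSupport (fun p => b p i) := fun i =>
    hcb.comp_left (g := fun f : Fin n → ℝ => f i) rfl
  have e1 : ∀ (i : Fin n) (z : Zs n), ipz z (Pi.single i 1, 0) = z.1 i := by
    intro i z
    simp [ipz, Pi.single_apply]
  have e2 : ∀ (i : Fin n) (z : Zs n), ipz z (0, Pi.single i 1) = z.2 i := by
    intro i z
    simp [ipz, Pi.single_apply]
  have A := fun i => flux_all hn hl (ha' i) (hca' i) (v := (Pi.single i 1, 0))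
    (fun z => by rw [e1]; exact abs_fst_le z i) (w := fun z => z.2 i) (by fun_prop)
  have B := fun i => flux_all hn hl (hb' i) (hcb' i) (v := (0, Pi.single i 1))
    (fun z => by rw [e2]; exact abs_snd_le z i) (w := fun z => -z.1 i) (by fun_prop)
  simp only [e1] at A
  simp only [e2] at B
  have hX : ∀ i p, Xder (fun q => a q i) i p = fderiv ℝ (fun q => a q i) p (Pi.single i 1, 0, 0)
      + p.2.1 i * fderiv ℝ (fun q => a q i) p (0, 0, 1) := fun i p => rfl
  have hY : ∀ i p, Yder (fun q => b q i) i p = fderiv ℝ (fun q => b q i) p (0, Pi.single i 1, 0)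
      + -p.1 i * fderiv ℝ (fun q => b q i) p (0, 0, 1) := fun i p => by
    rw [Yder]; ring
  constructor
  · exact integrable_finsetSum _ fun i _ => (A i).2.1.add (B i).2.1
  · unfold hDivergence fluxT
    simp only [hX, hY]
    rw [integral_finsetSum, integral_finsetSum]
    · refine Finset.sum_congr rfl fun i _ => ?_
      rw [integral_add (A i).1.integrableOn (B i).1.integrableOn,
        integral_add (A i).2.1 (B i).2.1, (A i).2.2, (B i).2.2]
    · exact fun i _ => (A i).2.1.add (B i).2.1
    · exact fun i _ => (A i).1.integrableOn.add (B i).1.integrableOn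
/-! ### Upper bound -/

lemma cauchy_pair {n : ℕ} {a b c d : Fin n → ℝ} {W : ℝ} (hW : 0 ≤ W)
    (h1 : ∑ i, ((a i) ^ 2 + (b i) ^ 2) ≤ 1) (h2 : ∑ i, ((c i) ^ 2 + (d i) ^ 2) = W ^ 2) :
    ∑ i, (a i * c i + b i * d i) ≤ W := by
  have h := Finset.sum_mul_sq_le_sq_mul_sq Finset.univ (Sum.elim a b) (Sum.elim c d)
  simp only [Fintype.sum_sum_type, Sum.elim_inl, Sum.elim_inr, ← Finset.sum_add_distrib] at h
  rw [h2] at h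
  refine le_of_abs_le (abs_le_of_sq_le_sq ?_ hW)
  refine h.trans ?_
  nlinarith [sq_nonneg W]

lemma Wf_sq {n : ℕ} {lam : ℝ} (hl : 0 < lam) {z : Zs n} (h : lam ^ 2 * qf z < 1) :
    (lam ^ 2 * Wf lam z ^ 2 + 1) * qf z = Wf lam z ^ 2 := by
  have hp : 0 < 1 - lam ^ 2 * qf z := by linarith
  unfold Wf
  rw [mul_pow, inv_pow, zNorm2_sq, Real.sq_sqrt hp.le]
  field_simp
  ring

lemma fluxT_le {n : ℕ} {lam : ℝ} (hl : 0 < lam) {a b : Hei n → Fin n → ℝ}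
    (hab : ∀ p, ∑ i, ((a p i) ^ 2 + (b p i) ^ 2) ≤ 1) (z : Zs n) :
    fluxT lam a b z ≤ 2 * Wf lam z := by
  rcases lt_or_ge (lam ^ 2 * qf z) 1 with h | h
  · have hW := Wf_nonneg lam z
    have e : fluxT lam a b z =
        ∑ i, (a (emb z (Uf lam z)) i * (lam * Wf lam z * z.1 i + z.2 i)
          + b (emb z (Uf lam z)) i * (lam * Wf lam z * z.2 i - z.1 i))
        + ∑ i, (a (emb z (-Uf lam z)) i * (lam * Wf lam z * z.1 i - z.2 i)
          + b (emb z (-Uf lam z)) i * (lam * Wf lam z * z.2 i + z.1 i)) := by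
      rw [← Finset.sum_add_distrib, fluxT]
      refine Finset.sum_congr rfl fun i _ => ?_
      simp only [fluxI]
      ring
    have k1 : ∑ i, ((lam * Wf lam z * z.1 i + z.2 i) ^ 2
        + (lam * Wf lam z * z.2 i - z.1 i) ^ 2) = Wf lam z ^ 2 := by
      rw [← Wf_sq hl h, qf, Finset.mul_sum]
      exact Finset.sum_congr rfl fun i _ => by ring
    have k2 : ∑ i, ((lam * Wf lam z * z.1 i - z.2 i) ^ 2
        + (lam * Wf lam z * z.2 i + z.1 i) ^ 2) = Wf lam z ^ 2 := by
      rw [← Wf_sq hl h, qf, Finset.mul_sum]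
      exact Finset.sum_congr rfl fun i _ => by ring
    have c1 := cauchy_pair hW (hab (emb z (Uf lam z))) k1
    have c2 := cauchy_pair hW (hab (emb z (-Uf lam z))) k2
    rw [e]
    linarith
  · have hU : Uf lam z = 0 := gprof_of_ge hl h
    simp [fluxT, fluxI, Wf_of_ge h, hU]

/-! ### The recovery fields -/

/-- Cutoff vanishing for `w ≤ c` and equal to one for `w ≥ 2c`. -/
def chi (c w : ℝ) : ℝ := Real.smoothTransition (w / c - 1)

lemma chi_nonneg (c w : ℝ) : 0 ≤ chi c w := Real.smoothTransition.nonneg _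

lemma chi_le_one (c w : ℝ) : chi c w ≤ 1 := Real.smoothTransition.le_one _

lemma chi_zero {c w : ℝ} (hc : 0 < c) (h : w ≤ c) : chi c w = 0 := by
  apply Real.smoothTransition.zero_of_nonpos
  have : w / c ≤ 1 := (div_le_one hc).2 h
  linarith

lemma chi_one {c w : ℝ} (hc : 0 < c) (h : 2 * c ≤ w) : chi c w = 1 := by
  apply Real.smoothTransition.one_of_one_le
  have : 2 ≤ w / c := (le_div_iff₀ hc).2 h
  linarith

lemma contDiff_chi (c : ℝ) : ContDiff ℝ 1 (chi c) := by
  unfold chi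
  have h : ContDiff ℝ 1 Real.smoothTransition := Real.smoothTransition.contDiff
  exact h.comp (by fun_prop)

lemma contDiff_chi_sqrt {c : ℝ} (hc : 0 < c) : ContDiff ℝ 1 (fun w => chi c w * √w) := by
  rw [contDiff_iff_contDiffAt]
  intro w
  rcases le_or_gt w 0 with h | h
  · have : (fun w => chi c w * √w) =ᶠ[𝓝 w] fun _ => 0 := by
      filter_upwards [Iio_mem_nhds (lt_of_le_of_lt h hc)] with r hr
      rw [chi_zero hc (le_of_lt hr), zero_mul]
    exact contDiffAt_const.congr_of_eventuallyEq this
  · exact (contDiff_chi c).contDiffAt.mul (Real.contDiffAt_sqrt h.ne')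

/-- Horizontal rotation coefficient. -/
def sgm (lam c q : ℝ) : ℝ := chi c (1 - lam ^ 2 * q) * √(1 - lam ^ 2 * q) * (√(q + c))⁻¹

/-- Smoothed sign. -/
def tau (c t : ℝ) : ℝ := t * (√(t ^ 2 + c))⁻¹

lemma contDiff_tau {c : ℝ} (hc : 0 < c) : ContDiff ℝ 1 (tau c) := by
  unfold tau
  have hp : ∀ t : ℝ, t ^ 2 + c ≠ 0 := fun t => by positivity
  have hp' : ∀ t : ℝ, √(t ^ 2 + c) ≠ 0 := fun t => by positivity
  have h1 : ContDiff ℝ 1 fun t : ℝ => t ^ 2 + c := by fun_prop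
  exact contDiff_id.mul ((h1.sqrt hp).inv hp')

lemma tau_neg (c t : ℝ) : tau c (-t) = -tau c t := by
  simp [tau]

lemma tau_sq_le {c : ℝ} (hc : 0 < c) (t : ℝ) : tau c t ^ 2 ≤ 1 := by
  unfold tau
  have hp : 0 < t ^ 2 + c := by positivity
  rw [mul_pow, inv_pow, Real.sq_sqrt hp.le, ← div_eq_mul_inv, div_le_one hp]
  linarith

/-- First half of the recovery field. -/
def fa {n : ℕ} (lam c : ℝ) (κ : ℝ → ℝ) (p : Hei n) (i : Fin n) : ℝ :=
  κ p.2.2 * (lam * chi c (1 - lam ^ 2 * qf (p.1, p.2.1)) * p.1 i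
    + sgm lam c (qf (p.1, p.2.1)) * tau c p.2.2 * p.2.1 i)

/-- Second half of the recovery field. -/
def fb {n : ℕ} (lam c : ℝ) (κ : ℝ → ℝ) (p : Hei n) (i : Fin n) : ℝ :=
  κ p.2.2 * (lam * chi c (1 - lam ^ 2 * qf (p.1, p.2.1)) * p.2.1 i
    - sgm lam c (qf (p.1, p.2.1)) * tau c p.2.2 * p.1 i)

section fields

variable {n : ℕ} {lam c : ℝ} {κ : ℝ → ℝ}

lemma contDiff_q3 : ContDiff ℝ 1 (fun p : Hei n => qf (p.1, p.2.1)) :=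
  contDiff_qf.comp (by fun_prop)

lemma contDiff_chi3 : ContDiff ℝ 1 (fun p : Hei n => chi c (1 - lam ^ 2 * qf (p.1, p.2.1))) :=
  (contDiff_chi c).comp (contDiff_const.sub (contDiff_const.mul contDiff_q3))

lemma contDiff_sgm3 (hc : 0 < c) : ContDiff ℝ 1 (fun p : Hei n => sgm lam c (qf (p.1, p.2.1))) := by
  unfold sgm
  have hp : ∀ p : Hei n, 0 < qf (p.1, p.2.1) + c := fun p => by
    have := qf_nonneg (p.1, p.2.1)
    linarith
  have h1 : ContDiff ℝ 1 (fun p : Hei n => chi c (1 - lam ^ 2 * qf (p.1, p.2.1))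
      * √(1 - lam ^ 2 * qf (p.1, p.2.1))) :=
    (contDiff_chi_sqrt hc).comp (contDiff_const.sub (contDiff_const.mul contDiff_q3))
  exact h1.mul (((contDiff_q3.add contDiff_const).sqrt (fun p => (hp p).ne')).inv
    (fun p => (Real.sqrt_pos.2 (hp p)).ne'))

lemma contDiff_tau3 (hc : 0 < c) : ContDiff ℝ 1 (fun p : Hei n => tau c p.2.2) :=
  (contDiff_tau hc).comp (by fun_prop)

lemma contDiff_fa (hc : 0 < c) (hκ : ContDiff ℝ 1 κ) :
    ContDiff ℝ 1 (fa lam c κ : Hei n → Fin n → ℝ) := by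
  rw [contDiff_pi]
  intro i
  have h1 := contDiff_chi3 (n := n) (lam := lam) (c := c)
  have h2 := contDiff_sgm3 (n := n) (lam := lam) hc
  have h3 := contDiff_tau3 (n := n) hc
  have h4 : ContDiff ℝ 1 (fun p : Hei n => κ p.2.2) := hκ.comp (by fun_prop)
  unfold fa
  fun_prop

lemma contDiff_fb (hc : 0 < c) (hκ : ContDiff ℝ 1 κ) :
    ContDiff ℝ 1 (fb lam c κ : Hei n → Fin n → ℝ) := by
  rw [contDiff_pi]
  intro i
  have h1 := contDiff_chi3 (n := n) (lam := lam) (c := c)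
  have h2 := contDiff_sgm3 (n := n) (lam := lam) hc
  have h3 := contDiff_tau3 (n := n) hc
  have h4 : ContDiff ℝ 1 (fun p : Hei n => κ p.2.2) := hκ.comp (by fun_prop)
  unfold fb
  fun_prop

lemma sgm_sq_le (hc : 0 < c) (z : Zs n) :
    sgm lam c (qf z) ^ 2 * qf z ≤
      chi c (1 - lam ^ 2 * qf z) ^ 2 * (1 - lam ^ 2 * qf z) := by
  have hq := qf_nonneg z
  have hp : 0 < qf z + c := by linarith
  rcases le_or_gt (1 - lam ^ 2 * qf z) c with h | h
  · simp [sgm, chi_zero hc h]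
  · unfold sgm
    rw [mul_pow, mul_pow, inv_pow, Real.sq_sqrt hp.le, Real.sq_sqrt (by linarith), mul_assoc]
    refine mul_le_of_le_one_right (mul_nonneg (sq_nonneg _) (by linarith)) ?_
    rw [inv_mul_le_iff₀ hp]
    linarith

lemma field_le (hc : 0 < c) (hκ0 : ∀ t, 0 ≤ κ t) (hκ1 : ∀ t, κ t ≤ 1) (p : Hei n) :
    ∑ i, ((fa lam c κ p i) ^ 2 + (fb lam c κ p i) ^ 2) ≤ 1 := by
  obtain ⟨x, y, t⟩ := p
  have e : ∑ i, ((fa lam c κ (x, y, t) i) ^ 2 + (fb lam c κ (x, y, t) i) ^ 2)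
      = κ t ^ 2 * (lam ^ 2 * chi c (1 - lam ^ 2 * qf (x, y)) ^ 2 * qf (x, y)
        + (sgm lam c (qf (x, y)) ^ 2 * qf (x, y)) * tau c t ^ 2) := by
    have : κ t ^ 2 * (lam ^ 2 * chi c (1 - lam ^ 2 * qf (x, y)) ^ 2 * qf (x, y)
        + (sgm lam c (qf (x, y)) ^ 2 * qf (x, y)) * tau c t ^ 2) =
      κ t ^ 2 * (lam ^ 2 * chi c (1 - lam ^ 2 * qf (x, y)) ^ 2
        + sgm lam c (qf (x, y)) ^ 2 * tau c t ^ 2) * qf (x, y) := by ring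
    rw [this]
    conv_rhs => rw [show qf (x, y) = ∑ i, ((x i) ^ 2 + (y i) ^ 2) from rfl]
    rw [Finset.mul_sum]
    refine Finset.sum_congr rfl fun i _ => ?_
    simp only [fa, fb]
    rw [show qf (x, y) = ∑ i, ((x i) ^ 2 + (y i) ^ 2) from rfl]
    ring
  rw [e]
  have h1 := sgm_sq_le (lam := lam) hc (x, y)
  have h2 := tau_sq_le hc t
  have h3 : κ t ^ 2 ≤ 1 := pow_le_one₀ (hκ0 t) (hκ1 t)
  have h4 : chi c (1 - lam ^ 2 * qf (x, y)) ^ 2 ≤ 1 := pow_le_one₀ (chi_nonneg _ _) (chi_le_one _ _)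
  have hq := qf_nonneg (x, y)
  have h5 : (sgm lam c (qf (x, y)) ^ 2 * qf (x, y)) * tau c t ^ 2
      ≤ sgm lam c (qf (x, y)) ^ 2 * qf (x, y) :=
    mul_le_of_le_one_right (by positivity) h2
  refine mul_le_one₀ h3 (by positivity) ?_
  nlinarith

lemma compact_box (lam R : ℝ) : IsCompact ((Metric.closedBall (0 : Fin n → ℝ) (1 / lam)) ×ˢ
    ((Metric.closedBall (0 : Fin n → ℝ) (1 / lam)) ×ˢ (Metric.closedBall (0 : ℝ) R))) :=
  (isCompact_closedBall _ _).prod ((isCompact_closedBall _ _).prod (isCompact_closedBall _ _))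

lemma out_box (hl : 0 < lam) (hc : 0 < c) {R : ℝ} (hκR : ∀ t, R < |t| → κ t = 0) {p : Hei n}
    (hp : p ∉ (Metric.closedBall (0 : Fin n → ℝ) (1 / lam)) ×ˢ
    ((Metric.closedBall (0 : Fin n → ℝ) (1 / lam)) ×ˢ (Metric.closedBall (0 : ℝ) R))) :
    κ p.2.2 = 0 ∨ chi c (1 - lam ^ 2 * qf (p.1, p.2.1)) = 0 := by
  by_cases h : (p.1, p.2.1) ∈ Metric.closedBall (0 : Zs n) (1 / lam)
  · left
    apply hκR
    by_contra hR
    apply hp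
    have h' : p.1 ∈ Metric.closedBall (0 : Fin n → ℝ) (1 / lam) ∧
        p.2.1 ∈ Metric.closedBall (0 : Fin n → ℝ) (1 / lam) := by
      simpa [Prod.norm_def] using h
    refine ⟨h'.1, h'.2, ?_⟩
    simpa using hR
  · right
    have := one_lt_of_not_mem hl h
    exact chi_zero hc (by linarith)

lemma support_fa (hl : 0 < lam) (hc : 0 < c) {R : ℝ} (hκR : ∀ t, R < |t| → κ t = 0) :
    HasCompactSupport (fa lam c κ : Hei n → Fin n → ℝ) := by
  refine HasCompactSupport.intro (compact_box lam R) fun p hp => ?_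
  funext i
  rcases out_box hl hc hκR hp with h | h
  · simp [fa, h]
  · simp [fa, sgm, h]

lemma support_fb (hl : 0 < lam) (hc : 0 < c) {R : ℝ} (hκR : ∀ t, R < |t| → κ t = 0) :
    HasCompactSupport (fb lam c κ : Hei n → Fin n → ℝ) := by
  refine HasCompactSupport.intro (compact_box lam R) fun p hp => ?_
  funext i
  rcases out_box hl hc hκR hp with h | h
  · simp [fb, h]
  · simp [fb, sgm, h]

lemma fluxT_field (z : Zs n) (h1 : κ (Uf lam z) = 1) (h2 : κ (-Uf lam z) = 1) :
    fluxT lam (fa lam c κ) (fb lam c κ) z =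
      2 * (lam ^ 2 * Wf lam z * chi c (1 - lam ^ 2 * qf z)
        + sgm lam c (qf z) * tau c (Uf lam z)) * qf z := by
  conv_rhs => rw [show ∀ r, r * qf z = r * ∑ i, ((z.1 i) ^ 2 + (z.2 i) ^ 2) from fun r => rfl]
  rw [Finset.mul_sum, fluxT]
  refine Finset.sum_congr rfl fun i _ => ?_
  simp only [fluxI, fa, fb, emb, h1, h2, tau_neg]
  ring

lemma fluxT_field_nonneg (hl : 0 < lam) (z : Zs n) (h1 : κ (Uf lam z) = 1)
    (h2 : κ (-Uf lam z) = 1) : 0 ≤ fluxT lam (fa lam c κ) (fb lam c κ) z := by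
  rw [fluxT_field z h1 h2]
  have a1 := qf_nonneg z
  have a2 := Wf_nonneg lam z
  have a3 := chi_nonneg c (1 - lam ^ 2 * qf z)
  have a4 : 0 ≤ Uf lam z := gprof_nonneg hl _
  have a5 : 0 ≤ sgm lam c (qf z) := by unfold sgm; positivity
  have a6 : 0 ≤ tau c (Uf lam z) := by unfold tau; positivity
  positivity

end fields

lemma tendsto_fluxT {n : ℕ} {lam : ℝ} (hl : 0 < lam) {κ : ℝ → ℝ} (z : Zs n)
    (h1 : κ (Uf lam z) = 1) (h2 : κ (-Uf lam z) = 1) :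
    Tendsto (fun m => fluxT lam (fa lam (cseq m) κ) (fb lam (cseq m) κ) z) atTop
      (𝓝 (2 * Wf lam z)) := by
  simp_rw [fluxT_field z h1 h2]
  rcases lt_or_ge (lam ^ 2 * qf z) 1 with h | h
  · rcases (qf_nonneg z).eq_or_lt with h0 | h0
    · have : zNorm2 z = 0 := by rw [zNorm2_eq, ← h0, Real.sqrt_zero]
      simp [← h0, Wf, this]
    · have hU : 0 < Uf lam z := gprof_pos hl h
      have hw : 0 < 1 - lam ^ 2 * qf z := by linarith
      have t0 := tendsto_cseq
      have t1 : Tendsto (fun m => chi (cseq m) (1 - lam ^ 2 * qf z)) atTop (𝓝 1) := by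
        refine tendsto_const_nhds.congr' ?_
        filter_upwards [t0.eventually (Iio_mem_nhds (half_pos hw))] with m hm
        refine (chi_one (cseq_pos m) ?_).symm
        have : cseq m < (1 - lam ^ 2 * qf z) / 2 := hm
        linarith
      have t2 : Tendsto (fun m => (√(qf z + cseq m))⁻¹) atTop (𝓝 (√(qf z + 0))⁻¹) := by
        refine Tendsto.inv₀ ?_ (by simpa using (Real.sqrt_pos.2 h0).ne')
        exact (Real.continuous_sqrt.tendsto _).comp (t0.const_add _)
      have t3 : Tendsto (fun m => (√(Uf lam z ^ 2 + cseq m))⁻¹) atTop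
          (𝓝 (√(Uf lam z ^ 2 + 0))⁻¹) := by
        refine Tendsto.inv₀ ?_ (by rw [add_zero, Real.sqrt_sq hU.le]; exact hU.ne')
        exact (Real.continuous_sqrt.tendsto _).comp (t0.const_add _)
      have t4 := ((((t1.const_mul (lam ^ 2 * Wf lam z)).add
        (((t1.mul_const (√(1 - lam ^ 2 * qf z))).mul t2).mul
          (t3.const_mul (Uf lam z)))).const_mul 2).mul_const (qf z))
      refine (t4.congr fun m => rfl).trans (le_of_eq ?_)
      congr 1
      rw [add_zero, add_zero, Real.sqrt_sq hU.le, mul_inv_cancel₀ hU.ne', Wf, zNorm2_sq,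
        zNorm2_eq]
      have hs := Real.sqrt_pos.2 h0
      have hs2 : √(qf z) ^ 2 = qf z := Real.sq_sqrt h0.le
      have hr := Real.sqrt_pos.2 hw
      have hr2 : √(1 - lam ^ 2 * qf z) ^ 2 = 1 - lam ^ 2 * qf z := Real.sq_sqrt hw.le
      generalize √(1 - lam ^ 2 * qf z) = r at *
      generalize √(qf z) = s at *
      rw [← hs2] at hr2 ⊢
      field_simp
      rw [hr2]
      ring
  · have hc : ∀ m, chi (cseq m) (1 - lam ^ 2 * qf z) = 0 := fun m =>
      chi_zero (cseq_pos m) (by have := cseq_pos m; linarith)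
    simp [hc, sgm, Wf_of_ge h]

lemma exists_cutoff {n : ℕ} {lam : ℝ} (hl : 0 < lam) :
    ∃ (κ : ℝ → ℝ) (R : ℝ), ContDiff ℝ 1 κ ∧ (∀ t, 0 ≤ κ t) ∧ (∀ t, κ t ≤ 1) ∧
      (∀ t, R < |t| → κ t = 0) ∧ ∀ z : Zs n, κ (Uf lam z) = 1 ∧ κ (-Uf lam z) = 1 := by
  obtain ⟨T, hT⟩ := (continuous_Uf (n := n) lam).bounded_above_of_compact_support
    (hasCompactSupport_Uf hl)
  have hT0 : 0 ≤ T := (norm_nonneg _).trans (hT 0)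
  let κ : ContDiffBump (0 : ℝ) := ⟨T + 1, T + 2, by linarith, by linarith⟩
  refine ⟨κ, T + 2, κ.contDiff, fun t => κ.nonneg, fun t => κ.le_one, fun t ht => ?_, fun z => ?_⟩
  · apply κ.zero_of_le_dist
    simpa using ht.le
  · have := hT z
    constructor
    · apply κ.one_of_mem_closedBall
      rw [mem_closedBall_zero_iff]
      show ‖Uf lam z‖ ≤ T + 1
      linarith
    · apply κ.one_of_mem_closedBall
      rw [mem_closedBall_zero_iff, norm_neg]
      show ‖Uf lam z‖ ≤ T + 1
      linarith

/-- The horizontal perimeter of the Pansu ball equals the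
sub-Riemannian area of its two boundary graphs:
`P(B_λ) = 2∫_{|z|<1/λ} |z|(1−λ²|z|²)^{−1/2} dz`. -/
theorem pansuBall_perimeter_integral_formula
    (n : ℕ) (hn : 1 ≤ n) (lam : ℝ) (hlam : 0 < lam) :
    hPerimeter (pansuBall n lam) Set.univ
      = ENNReal.ofReal (2 * ∫ z in {z : (Fin n → ℝ) × (Fin n → ℝ) | zNorm2 z < 1 / lam},
          zNorm2 z * (Real.sqrt (1 - lam ^ 2 * zNorm2 z ^ 2))⁻¹) := by
  have hR : ∫ z in {z : (Fin n → ℝ) × (Fin n → ℝ) | zNorm2 z < 1 / lam},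
      zNorm2 z * (Real.sqrt (1 - lam ^ 2 * zNorm2 z ^ 2))⁻¹ = ∫ z : Zs n, Wf lam z := by
    refine setIntegral_eq_integral_of_forall_compl_eq_zero (f := Wf lam) fun z hz => ?_
    have hz' : 1 / lam ≤ zNorm2 z := not_lt.1 hz
    rw [div_le_iff₀ hlam] at hz'
    apply Wf_of_ge
    rw [← zNorm2_sq]
    nlinarith
  rw [hR, ← integral_const_mul]
  have hWi : Integrable (fun z : Zs n => 2 * Wf lam z) := (integrable_Wf hn hlam).const_mul 2
  apply le_antisymm
  · refine iSup_le fun ab => ENNReal.ofReal_le_ofReal ?_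
    obtain ⟨⟨a, b⟩, ha, hb, hca, hcb, -, -, hab⟩ := ab
    obtain ⟨hi, he⟩ := flux_total hn hlam ha hb hca hcb
    show ∫ p in pansuBall n lam, hDivergence a b p ≤ _
    rw [he]
    exact integral_mono hi hWi fun z => fluxT_le hlam hab z
  · obtain ⟨κ, R, hκ, hκ0, hκ1, hκR, hκU⟩ := exists_cutoff (n := n) hlam
    have adm : ∀ m, IsAdmissible (n := n) Set.univ (fa lam (cseq m) κ) (fb lam (cseq m) κ) :=
      fun m => ⟨contDiff_fa (cseq_pos m) hκ, contDiff_fb (cseq_pos m) hκ,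
        support_fa hlam (cseq_pos m) hκR, support_fb hlam (cseq_pos m) hκR,
        subset_univ _, subset_univ _, field_le (cseq_pos m) hκ0 hκ1⟩
    have ft := fun m => flux_total hn hlam (adm m).1 (adm m).2.1 (adm m).2.2.1 (adm m).2.2.2.1
    have T : Tendsto (fun m => ∫ z : Zs n, fluxT lam (fa lam (cseq m) κ) (fb lam (cseq m) κ) z)
        atTop (𝓝 (∫ z : Zs n, 2 * Wf lam z)) := by
      refine tendsto_integral_of_dominated_convergence (fun z => 2 * Wf lam z)
        (fun m => (ft m).1.aestronglyMeasurable) hWi ?_ ?_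
      · refine fun m => Eventually.of_forall fun z => ?_
        rw [Real.norm_eq_abs, abs_of_nonneg (fluxT_field_nonneg hlam z (hκU z).1 (hκU z).2)]
        exact fluxT_le hlam (adm m).2.2.2.2.2.2 z
      · exact Eventually.of_forall fun z => tendsto_fluxT hlam z (hκU z).1 (hκU z).2
    refine le_of_tendsto' (ENNReal.tendsto_ofReal T) fun m => ?_
    rw [← (ft m).2]
    exact le_iSup (fun ab : {ab : (Hei n → Fin n → ℝ) × (Hei n → Fin n → ℝ) //
      IsAdmissible Set.univ ab.1 ab.2} =>
      ENNReal.ofReal (∫ p in pansuBall n lam, hDivergence ab.1.1 ab.1.2 p)) ⟨(_, _), adm m⟩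

end
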